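/- arXiv:2406.18798 — 2 statements merged into one kernel-verified Lean document; each statement's English description precedes it below -/
import Mathlib

section
/- (Entropic Balog–Szemerédi–Gowers theorem.) Let X and Y be discrete random variables taking values in the same abelian group, with finite entropies, and suppose A{X,Y} ≥ (3/2)·H{X} + (3/2)·H{Y} − log C for some constant C > 0. Let (X₁, Y₁) and (X₂, Y₂) be conditionally independent trials of (X,Y) relative to X+Y. Then H{X₁ | X+Y} ≥ H{X} − 2 log C, H{Y₂ | X+Y} ≥ H{Y} − 2 log C, the variables X₁ and Y₂ are conditionally independent relative to X+Y, and H{X₁ + Y₂ | X+Y} ≤ (1/2)·H{X} + (1/2)·H{Y} + log C. -/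
open MeasureTheory ProbabilityTheory Real

/-- Shannon entropy (base 2) of a discrete random variable `X : Ω → S`
under the measure `μ`. -/
noncomputable def entH {Ω S : Type*} [MeasurableSpace Ω] (μ : Measure Ω) (X : Ω → S) : ℝ :=
  ∑' s : S, -((μ (X ⁻¹' {s})).toReal * Real.logb 2 (μ (X ⁻¹' {s})).toReal)

/-- The random variable `X` has finite (Shannon) entropy. -/
def FinEnt {Ω S : Type*} [MeasurableSpace Ω] (μ : Measure Ω) (X : Ω → S) : Prop :=
  Summable fun s : S => -((μ (X ⁻¹' {s})).toReal * Real.logb 2 (μ (X ⁻¹' {s})).toReal)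

/-- Conditional Shannon entropy (base 2) `H{X | Z} = ∑ₜ P(Z = t) · H{X | Z = t}`. -/
noncomputable def condEntH {Ω S T : Type*} [MeasurableSpace Ω] (μ : Measure Ω)
    (X : Ω → S) (Z : Ω → T) : ℝ :=
  ∑' t : T, (μ (Z ⁻¹' {t})).toReal * entH (μ[|Z ⁻¹' {t}]) X

open scoped ENNReal

/-- pointwise information function -/
noncomputable def infoI {Ω S : Type*} [MeasurableSpace Ω] (μ : Measure Ω) (X : Ω → S) (ω : Ω) : ℝ :=
  -Real.logb 2 (μ (X ⁻¹' {X ω})).toReal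

section helpers

set_option linter.unusedSectionVars false

variable {Ω : Type*} [MeasurableSpace Ω] {S T U : Type*}
  [Countable S] [MeasurableSpace S] [MeasurableSingletonClass S]
  [Countable T] [MeasurableSpace T] [MeasurableSingletonClass T]
  [Countable U] [MeasurableSpace U] [MeasurableSingletonClass U]

lemma aux_integrable (μ : Measure Ω) [IsFiniteMeasure μ] (V : Ω → S) (hV : Measurable V)
    (F : S → ℝ) :
    Integrable (fun ω => F (V ω)) μ ↔ Summable fun s => (μ (V ⁻¹' {s})).toReal * F s := by
  have h1 : Integrable (fun ω => F (V ω)) μ ↔ Integrable F (μ.map V) :=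
    (integrable_map_measure (Measurable.of_discrete (f := F)).aestronglyMeasurable
      hV.aemeasurable).symm
  rw [h1]
  conv_lhs => rw [← Measure.sum_smul_dirac (μ.map V)]
  rw [integrable_sum_dirac_iff (fun i => measure_ne_top _ _),
    ← summable_abs_iff (f := fun s => (μ (V ⁻¹' {s})).toReal * F s)]
  refine summable_congr fun s => ?_
  rw [Measure.map_apply hV (measurableSet_singleton s), abs_mul, abs_of_nonneg ENNReal.toReal_nonneg,
    Real.norm_eq_abs]

lemma aux_integral (μ : Measure Ω) [IsFiniteMeasure μ] (V : Ω → S) (hV : Measurable V)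
    (F : S → ℝ) (h : Integrable (fun ω => F (V ω)) μ) :
    ∫ ω, F (V ω) ∂μ = ∑' s, (μ (V ⁻¹' {s})).toReal * F s := by
  have h1 : Integrable (fun ω => F (V ω)) μ ↔ Integrable F (μ.map V) :=
    (integrable_map_measure (Measurable.of_discrete (f := F)).aestronglyMeasurable
      hV.aemeasurable).symm
  rw [← integral_map hV.aemeasurable (Measurable.of_discrete (f := F)).aestronglyMeasurable,
    integral_countable (h1.1 h)]
  refine tsum_congr fun s => ?_
  rw [measureReal_def, Measure.map_apply hV (measurableSet_singleton s), smul_eq_mul]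

lemma finEnt_iff (μ : Measure Ω) [IsFiniteMeasure μ] (V : Ω → S) (hV : Measurable V) :
    FinEnt μ V ↔ Integrable (infoI μ V) μ := by
  have := aux_integrable μ V hV (fun s => -Real.logb 2 (μ (V ⁻¹' {s})).toReal)
  unfold FinEnt
  rw [show infoI μ V = (fun ω => -Real.logb 2 (μ (V ⁻¹' {V ω})).toReal) from rfl, this]
  simp

lemma entH_eq (μ : Measure Ω) [IsFiniteMeasure μ] (V : Ω → S) (hV : Measurable V)
    (h : Integrable (infoI μ V) μ) :
    entH μ V = ∫ ω, infoI μ V ω ∂μ := by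
  have := aux_integral μ V hV (fun s => -Real.logb 2 (μ (V ⁻¹' {s})).toReal) h
  unfold entH
  rw [show infoI μ V = (fun ω => -Real.logb 2 (μ (V ⁻¹' {V ω})).toReal) from rfl, this]
  simp

lemma infoI_meas (μ : Measure Ω) (V : Ω → S) (hV : Measurable V) : Measurable (infoI μ V) :=
  (Measurable.of_discrete (f := fun s => -Real.logb 2 (μ (V ⁻¹' {s})).toReal)).comp hV


lemma infoI_nonneg (μ : Measure Ω) [IsProbabilityMeasure μ] (V : Ω → S) (ω : Ω) :
    0 ≤ infoI μ V ω := by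
  unfold infoI
  rw [neg_nonneg]
  refine Real.logb_nonpos one_lt_two ENNReal.toReal_nonneg ?_
  exact ENNReal.toReal_le_of_le_ofReal zero_le_one (by simpa using prob_le_one)

lemma pos_ae (μ : Measure Ω) (V : Ω → S) :
    ∀ᵐ ω ∂μ, μ (V ⁻¹' {V ω}) ≠ 0 := by
  rw [ae_iff]
  have : {a | ¬ μ (V ⁻¹' {V a}) ≠ 0} ⊆ ⋃ s ∈ {s | μ (V ⁻¹' {s}) = 0}, V ⁻¹' {s} := by
    intro a ha
    simp only [ne_eq, not_not, Set.mem_ofPred_eq] at ha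
    simp only [Set.mem_iUnion]
    exact ⟨V a, ha, rfl⟩
  refine measure_mono_null this ?_
  rw [measure_biUnion_null_iff (Set.to_countable _)]
  intro s hs
  exact hs

lemma infoI_mono (μ : Measure Ω) [IsProbabilityMeasure μ] (A : Ω → S) (D : Ω → U)
    (f : S → U) (h : ∀ᵐ ω ∂μ, D ω = f (A ω)) :
    ∀ᵐ ω ∂μ, infoI μ D ω ≤ infoI μ A ω := by
  filter_upwards [h, pos_ae μ A] with ω h1 h2
  unfold infoI
  rw [neg_le_neg_iff]
  refine Real.logb_le_logb_of_le one_lt_two (ENNReal.toReal_pos h2 (measure_ne_top _ _)) ?_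
  refine ENNReal.toReal_mono (measure_ne_top _ _) (measure_mono_ae ?_)
  filter_upwards [h] with ω' h'
  intro (h3 : A ω' = A ω)
  change D ω' = D ω
  rw [h', h3, h1]

lemma infoI_integrable_mono (μ : Measure Ω) [IsProbabilityMeasure μ] (A : Ω → S) (D : Ω → U)
    (hD : Measurable D)
    (f : S → U) (h : ∀ᵐ ω ∂μ, D ω = f (A ω)) (hI : Integrable (infoI μ A) μ) :
    Integrable (infoI μ D) μ := by
  refine hI.mono (infoI_meas μ D hD).aestronglyMeasurable ?_
  filter_upwards [infoI_mono μ A D f h] with ω hω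
  rw [Real.norm_of_nonneg (infoI_nonneg μ D ω), Real.norm_of_nonneg (infoI_nonneg μ A ω)]
  exact hω

lemma ratio_le (μ : Measure Ω) [IsProbabilityMeasure μ] (A : Ω → S) (B : Ω → T) (D : Ω → U)
    (hA : Measurable A) (hB : Measurable B)
    (f : S → U) (g : T → U) (hf : ∀ᵐ ω ∂μ, D ω = f (A ω)) (hg : ∀ᵐ ω ∂μ, D ω = g (B ω)) :
    ∫⁻ ω, μ (A ⁻¹' {A ω}) * μ (B ⁻¹' {B ω}) * (μ ((fun ω => (A ω, B ω)) ⁻¹' {(A ω, B ω)}))⁻¹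
      * (μ (D ⁻¹' {D ω}))⁻¹ ∂μ ≤ 1 := by
  classical
  set P : S × T → ℝ≥0∞ := fun p => μ ((fun ω => (A ω, B ω)) ⁻¹' {p}) with hP
  set R : S × T → ℝ≥0∞ := fun p => μ (A ⁻¹' {p.1}) * μ (B ⁻¹' {p.2}) * (P p)⁻¹
      * (μ (D ⁻¹' {f p.1}))⁻¹ with hR
  have hAB : Measurable (fun ω => (A ω, B ω)) := hA.prodMk hB
  have e1 : ∫⁻ ω, μ (A ⁻¹' {A ω}) * μ (B ⁻¹' {B ω}) *
      (μ ((fun ω => (A ω, B ω)) ⁻¹' {(A ω, B ω)}))⁻¹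
      * (μ (D ⁻¹' {D ω}))⁻¹ ∂μ = ∫⁻ ω, R (A ω, B ω) ∂μ := by
    refine lintegral_congr_ae ?_
    filter_upwards [hf] with ω h
    simp only [hR, hP, h]
  rw [e1, ← lintegral_map (f := R) (g := fun ω => (A ω, B ω)) Measurable.of_discrete hAB,
    lintegral_countable']
  have e2 : ∀ p : S × T, R p * (μ.map fun ω => (A ω, B ω)) {p} ≤
      μ (A ⁻¹' {p.1}) * (μ (D ⁻¹' {f p.1}))⁻¹ * (if g p.2 = f p.1 then μ (B ⁻¹' {p.2}) else 0) := by
    intro p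
    rw [Measure.map_apply hAB (measurableSet_singleton p)]
    change R p * P p ≤ _
    by_cases h0 : P p = 0
    · simp [h0]
    have hgf : g p.2 = f p.1 := by
      by_contra hne
      apply h0
      have : ∀ᵐ ω ∂μ, ω ∉ (fun ω => (A ω, B ω)) ⁻¹' {p} := by
        filter_upwards [hf, hg] with ω h1 h2
        intro (h3 : (A ω, B ω) = p)
        apply hne
        rw [← h3, ← h1, ← h2]
      rw [ae_iff] at this
      simpa only [not_not, Set.ofPred_mem_eq] using this
    rw [if_pos hgf]
    simp only [hR]
    have : (P p)⁻¹ * P p = 1 := ENNReal.inv_mul_cancel h0 (measure_ne_top _ _)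
    calc _ = μ (A ⁻¹' {p.1}) * (μ (D ⁻¹' {f p.1}))⁻¹ * μ (B ⁻¹' {p.2}) * ((P p)⁻¹ * P p) := by ring
      _ ≤ _ := by rw [this, mul_one]
  refine (ENNReal.tsum_le_tsum e2).trans ?_
  rw [ENNReal.tsum_prod (f := fun a b => μ (A ⁻¹' {a}) * (μ (D ⁻¹' {f a}))⁻¹ *
      (if g b = f a then μ (B ⁻¹' {b}) else 0))]
  have e3 : ∀ a : S, ∑' b : T, μ (A ⁻¹' {a}) * (μ (D ⁻¹' {f a}))⁻¹ *
      (if g b = f a then μ (B ⁻¹' {b}) else 0) ≤ μ (A ⁻¹' {a}) := by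
    intro a
    rw [ENNReal.tsum_mul_left]
    have : ∑' b : T, (if g b = f a then μ (B ⁻¹' {b}) else 0) = μ (D ⁻¹' {f a}) := by
      have h1 := tsum_measure_preimage_singleton (μ := μ) (s := {b | g b = f a}) (Set.to_countable _)
        (f := B) (fun y _ => hB (measurableSet_singleton y))
      rw [tsum_subtype {b | g b = f a} (fun b => μ (B ⁻¹' {b}))] at h1
      simp only [Set.indicator, Set.mem_ofPred_eq] at h1
      rw [h1]
      refine measure_congr ?_
      filter_upwards [hg] with ω h
      change (g (B ω) = f a) = (D ω = f a)
      rw [h]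
    rw [this, mul_assoc]
    calc _ ≤ μ (A ⁻¹' {a}) * 1 := by gcongr; exact ENNReal.inv_mul_le_one _
      _ = _ := mul_one _
  refine (ENNReal.tsum_le_tsum e3).trans ?_
  have h1 := tsum_measure_preimage_singleton (μ := μ) (s := Set.univ) (Set.to_countable _)
        (f := A) (fun y _ => hA (measurableSet_singleton y))
  rw [tsum_univ (fun b => μ (A ⁻¹' {b}))] at h1
  rw [h1]; simp

lemma submod (μ : Measure Ω) [IsProbabilityMeasure μ] (A : Ω → S) (B : Ω → T) (D : Ω → U)
    (hA : Measurable A) (hB : Measurable B) (hD : Measurable D)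
    (f : S → U) (g : T → U) (hf : ∀ᵐ ω ∂μ, D ω = f (A ω)) (hg : ∀ᵐ ω ∂μ, D ω = g (B ω))
    (hIA : Integrable (infoI μ A) μ) (hIB : Integrable (infoI μ B) μ) :
    Integrable (infoI μ (fun ω => (A ω, B ω))) μ ∧
    ∫ ω, infoI μ (fun ω => (A ω, B ω)) ω ∂μ + ∫ ω, infoI μ D ω ∂μ
      ≤ ∫ ω, infoI μ A ω ∂μ + ∫ ω, infoI μ B ω ∂μ := by
  have hID := infoI_integrable_mono μ A D hD f hf hIA
  have hAB : Measurable (fun ω => (A ω, B ω)) := hA.prodMk hB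
  have hr := ratio_le μ A B D hA hB f g hf hg
  set r : Ω → ℝ≥0∞ := fun ω => μ (A ⁻¹' {A ω}) * μ (B ⁻¹' {B ω}) *
    (μ ((fun ω => (A ω, B ω)) ⁻¹' {(A ω, B ω)}))⁻¹ * (μ (D ⁻¹' {D ω}))⁻¹ with hrdef
  have hrm : Measurable r := by
    have h1 := (Measurable.of_discrete (f := fun s => μ (A ⁻¹' {s}))).comp hA
    have h2 := (Measurable.of_discrete (f := fun s => μ (B ⁻¹' {s}))).comp hB
    have h3 := (Measurable.of_discrete (f := fun s => μ ((fun ω => (A ω, B ω)) ⁻¹' {s}))).comp hAB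
    have h4 := (Measurable.of_discrete (f := fun s => μ (D ⁻¹' {s}))).comp hD
    exact ((h1.mul h2).mul h3.inv).mul h4.inv
  have hrfin : ∫⁻ ω, r ω ∂μ ≠ ∞ := ne_top_of_le_ne_top ENNReal.one_ne_top hr
  have hri : Integrable (fun ω => (r ω).toReal) μ :=
    integrable_toReal_of_lintegral_ne_top hrm.aemeasurable hrfin
  have hrint : ∫ ω, (r ω).toReal ∂μ ≤ 1 := by
    rw [integral_toReal hrm.aemeasurable (ae_lt_top hrm hrfin)]
    exact ENNReal.toReal_le_of_le_ofReal zero_le_one (by simpa using hr)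
  have key : ∀ᵐ ω ∂μ, infoI μ (fun ω => (A ω, B ω)) ω ≤
      infoI μ A ω + infoI μ B ω - infoI μ D ω + ((r ω).toReal - 1) / Real.log 2 := by
    filter_upwards [pos_ae μ A, pos_ae μ B, pos_ae μ D, pos_ae μ (fun ω => (A ω, B ω))]
      with ω a b d ab
    have a' := ENNReal.toReal_pos a (measure_ne_top _ _)
    have b' := ENNReal.toReal_pos b (measure_ne_top _ _)
    have d' := ENNReal.toReal_pos d (measure_ne_top _ _)
    have ab' := ENNReal.toReal_pos ab (measure_ne_top _ _)
    have hrr : (r ω).toReal = (μ (A ⁻¹' {A ω})).toReal * (μ (B ⁻¹' {B ω})).toReal *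
      ((μ ((fun ω => (A ω, B ω)) ⁻¹' {(A ω, B ω)})).toReal)⁻¹ * ((μ (D ⁻¹' {D ω})).toReal)⁻¹ := by
      simp only [hrdef, ENNReal.toReal_mul, ENNReal.toReal_inv]
    have hl := Real.log_le_sub_one_of_pos (x := (r ω).toReal) (by rw [hrr]; positivity)
    have h2 : 0 < Real.log 2 := Real.log_pos one_lt_two
    have hl2 := div_le_div_of_nonneg_right hl h2.le
    refine le_trans (le_of_eq ?_) (add_le_add_right hl2 _)
    unfold infoI Real.logb
    rw [hrr, Real.log_mul (by positivity) (by positivity), Real.log_mul (by positivity) (by positivity),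
      Real.log_mul (by positivity) (by positivity), Real.log_inv, Real.log_inv]
    ring
  have hbi : Integrable (fun ω => infoI μ A ω + infoI μ B ω - infoI μ D ω +
      ((r ω).toReal - 1) / Real.log 2) μ :=
    ((hIA.add hIB).sub hID).add ((hri.sub (integrable_const 1)).div_const _)
  have hIAB : Integrable (infoI μ (fun ω => (A ω, B ω))) μ := by
    refine hbi.mono (infoI_meas μ _ hAB).aestronglyMeasurable ?_
    filter_upwards [key] with ω hω
    rw [Real.norm_of_nonneg (infoI_nonneg μ _ ω)]
    exact hω.trans (Real.le_norm_self _)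
  refine ⟨hIAB, ?_⟩
  have hle := integral_mono_ae hIAB hbi key
  have i1 : Integrable (fun ω => infoI μ A ω + infoI μ B ω) μ := hIA.add hIB
  have i2 : Integrable (fun ω => infoI μ A ω + infoI μ B ω - infoI μ D ω) μ := i1.sub hID
  have i3 : Integrable (fun ω => (r ω).toReal - 1) μ := hri.sub (integrable_const 1)
  rw [integral_add i2 (i3.div_const _), integral_sub i1 hID, integral_add hIA hIB, integral_div,
    integral_sub hri (integrable_const 1)] at hle
  have : (∫ ω, (r ω).toReal ∂μ - ∫ ω, (1:ℝ) ∂μ) / Real.log 2 ≤ 0 := by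
    refine div_nonpos_of_nonpos_of_nonneg ?_ (Real.log_pos one_lt_two).le
    simp; exact hrint
  linarith

lemma subadd (μ : Measure Ω) [IsProbabilityMeasure μ] (A : Ω → S) (B : Ω → T)
    (hA : Measurable A) (hB : Measurable B)
    (hIA : Integrable (infoI μ A) μ) (hIB : Integrable (infoI μ B) μ) :
    Integrable (infoI μ (fun ω => (A ω, B ω))) μ ∧
    ∫ ω, infoI μ (fun ω => (A ω, B ω)) ω ∂μ
      ≤ ∫ ω, infoI μ A ω ∂μ + ∫ ω, infoI μ B ω ∂μ := by
  obtain ⟨h1, h2⟩ := submod μ A B (fun _ => ()) hA hB measurable_const (fun _ => ()) (fun _ => ())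
    (by simp) (by simp) hIA hIB
  refine ⟨h1, ?_⟩
  have h3 : 0 ≤ ∫ ω, infoI μ (fun _ : Ω => ()) ω ∂μ :=
    integral_nonneg fun ω => infoI_nonneg μ _ ω
  linarith

lemma condEntH_eq (μ : Measure Ω) [IsProbabilityMeasure μ] (V : Ω → S) (Z : Ω → T)
    (hV : Measurable V) (hZ : Measurable Z)
    (h : Integrable (infoI μ (fun ω => (Z ω, V ω))) μ) :
    condEntH μ V Z = ∫ ω, infoI μ (fun ω => (Z ω, V ω)) ω ∂μ - ∫ ω, infoI μ Z ω ∂μ := by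
  have hIZ := infoI_integrable_mono μ (fun ω => (Z ω, V ω)) Z hZ Prod.fst (by simp) h
  rw [← integral_sub h hIZ]
  have hZV : Measurable (fun ω => (Z ω, V ω)) := hZ.prodMk hV
  set F : T × S → ℝ := fun p => -Real.logb 2 (μ ((fun ω => (Z ω, V ω)) ⁻¹' {p})).toReal
    - -Real.logb 2 (μ (Z ⁻¹' {p.1})).toReal with hF
  have hint : Integrable (fun ω => F (Z ω, V ω)) μ := h.sub hIZ
  have e := aux_integral μ (fun ω => (Z ω, V ω)) hZV F hint
  have hs := (aux_integrable μ (fun ω => (Z ω, V ω)) hZV F).1 hint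
  change _ = ∫ ω, F (Z ω, V ω) ∂μ
  rw [e, hs.tsum_prod]
  unfold condEntH entH
  refine tsum_congr fun t => ?_
  rw [← tsum_mul_left]
  refine tsum_congr fun s => ?_
  have hset : (fun ω => (Z ω, V ω)) ⁻¹' {(t, s)} = Z ⁻¹' {t} ∩ V ⁻¹' {s} := by
    ext ω; simp
  simp only [hF, hset, cond_apply (hZ (measurableSet_singleton t)), ENNReal.toReal_mul,
    ENNReal.toReal_inv]
  by_cases h0 : μ (Z ⁻¹' {t} ∩ V ⁻¹' {s}) = 0
  · simp [h0]
  have h1 : μ (Z ⁻¹' {t}) ≠ 0 := fun h' => h0 (measure_mono_null Set.inter_subset_left h')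
  have h0' := ENNReal.toReal_pos h0 (measure_ne_top _ _)
  have h1' := ENNReal.toReal_pos h1 (measure_ne_top _ _)
  rw [Real.logb_mul (by positivity) (by positivity), Real.logb_inv]
  field_simp
  ring


lemma infoI_congr_dist (μ : Measure Ω) [IsProbabilityMeasure μ] (V W : Ω → S)
    (hV : Measurable V) (hW : Measurable W) (h : ∀ s, μ (V ⁻¹' {s}) = μ (W ⁻¹' {s})) :
    (Integrable (infoI μ V) μ ↔ Integrable (infoI μ W) μ) ∧ entH μ V = entH μ W := by
  rw [← finEnt_iff μ V hV, ← finEnt_iff μ W hW]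
  unfold FinEnt entH
  simp only [h, and_self]

lemma trial_law {G : Type*} [AddCommGroup G] [Countable G]
    [MeasurableSpace G] [MeasurableSingletonClass G]
    (μ : Measure Ω) [IsProbabilityMeasure μ]
    (X Y X₁ Y₁ : Ω → G) (hmX : Measurable X) (hmY : Measurable Y) (hmX₁ : Measurable X₁)
    (hmY₁ : Measurable Y₁) (hZ : Measurable fun ω => X ω + Y ω)
    (hsum1 : ∀ᵐ ω ∂μ, X₁ ω + Y₁ ω = X ω + Y ω)
    (ht : ∀ z : G, μ ((fun ω => X ω + Y ω) ⁻¹' {z}) ≠ 0 →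
        Measure.map (fun ω => (X₁ ω, Y₁ ω)) (μ[|(fun ω => X ω + Y ω) ⁻¹' {z}]) =
          Measure.map (fun ω => (X ω, Y ω)) (μ[|(fun ω => X ω + Y ω) ⁻¹' {z}])) :
    μ.map (fun ω => (X₁ ω, Y₁ ω)) = μ.map (fun ω => (X ω, Y ω)) := by
  refine Measure.ext_of_singleton fun a => ?_
  rw [Measure.map_apply (hmX₁.prodMk hmY₁) (measurableSet_singleton a),
    Measure.map_apply (hmX.prodMk hmY) (measurableSet_singleton a)]
  set E := (fun ω => X ω + Y ω) ⁻¹' {a.1 + a.2} with hE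
  have h1 : μ ((fun ω => (X₁ ω, Y₁ ω)) ⁻¹' {a}) = μ (E ∩ (fun ω => (X₁ ω, Y₁ ω)) ⁻¹' {a}) := by
    refine measure_congr ?_
    filter_upwards [hsum1] with ω h
    refine propext ⟨fun h' => ⟨?_, h'⟩, fun h' => h'.2⟩
    have h'' : (X₁ ω, Y₁ ω) = a := h'
    change X ω + Y ω = a.1 + a.2
    rw [← h'', h]
  have h2 : μ ((fun ω => (X ω, Y ω)) ⁻¹' {a}) = μ (E ∩ (fun ω => (X ω, Y ω)) ⁻¹' {a}) := by
    congr 1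
    ext ω
    refine ⟨fun h' => ⟨?_, h'⟩, fun h' => h'.2⟩
    have h'' : (X ω, Y ω) = a := h'
    change X ω + Y ω = a.1 + a.2
    rw [← h'']
  rw [h1, h2]
  by_cases h0 : μ E = 0
  · rw [measure_mono_null Set.inter_subset_left h0, measure_mono_null Set.inter_subset_left h0]
  have h3 := congrArg (fun ν => ν {a}) (ht _ h0)
  rw [Measure.map_apply (hmX₁.prodMk hmY₁) (measurableSet_singleton a),
    Measure.map_apply (hmX.prodMk hmY) (measurableSet_singleton a),
    cond_apply (hZ (measurableSet_singleton _)), cond_apply (hZ (measurableSet_singleton _))] at h3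
  exact (ENNReal.mul_right_inj (ENNReal.inv_ne_zero.2 (measure_ne_top _ _))
    (ENNReal.inv_ne_top.2 h0)).1 h3

lemma entH_of_map_eq (μ : Measure Ω) [IsProbabilityMeasure μ] (V W : Ω → S)
    (hV : Measurable V) (hW : Measurable W) (h : μ.map V = μ.map W)
    (hI : Integrable (infoI μ W) μ) :
    Integrable (infoI μ V) μ ∧ ∫ ω, infoI μ V ω ∂μ = ∫ ω, infoI μ W ω ∂μ := by
  have h1 : ∀ s, μ (V ⁻¹' {s}) = μ (W ⁻¹' {s}) := fun s => by
    rw [← Measure.map_apply hV (measurableSet_singleton s), h,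
      Measure.map_apply hW (measurableSet_singleton s)]
  obtain ⟨h2, h3⟩ := infoI_congr_dist μ V W hV hW h1
  refine ⟨h2.2 hI, ?_⟩
  rw [← entH_eq μ V hV (h2.2 hI), ← entH_eq μ W hW hI, h3]

lemma trial_info {G : Type*} [Countable G]
    [MeasurableSpace G] [MeasurableSingletonClass G]
    (μ : Measure Ω) [IsProbabilityMeasure μ] (Z : Ω → G) (V₁ : Ω → S) (V₂ : Ω → T)
    (hZ : Measurable Z) (s₁ : S → G) (s₂ : T → G)
    (h₁ : ∀ᵐ ω ∂μ, s₁ (V₁ ω) = Z ω) (h₂ : ∀ᵐ ω ∂μ, s₂ (V₂ ω) = Z ω)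
    (hi : ∀ z, μ (Z ⁻¹' {z}) ≠ 0 → IndepFun V₁ V₂ (μ[|Z ⁻¹' {z}])) :
    ∀ᵐ ω ∂μ, infoI μ (fun ω => (V₁ ω, V₂ ω)) ω = infoI μ V₁ ω + infoI μ V₂ ω - infoI μ Z ω := by
  filter_upwards [h₁, h₂, pos_ae μ Z, pos_ae μ V₁, pos_ae μ V₂, pos_ae μ (fun ω => (V₁ ω, V₂ ω))]
    with ω e1 e2 p0 p1 p2 p12
  have hind := (hi _ p0).measure_inter_preimage_eq_mul {V₁ ω} {V₂ ω} (measurableSet_singleton _)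
    (measurableSet_singleton _)
  have hmz := hZ (measurableSet_singleton (Z ω))
  rw [cond_apply hmz, cond_apply hmz, cond_apply hmz] at hind
  have a1 : μ (Z ⁻¹' {Z ω} ∩ V₁ ⁻¹' {V₁ ω}) = μ (V₁ ⁻¹' {V₁ ω}) := by
    refine measure_congr ?_
    filter_upwards [h₁] with ω' h
    refine propext ⟨fun h' => h'.2, fun h' => ⟨?_, h'⟩⟩
    have h'' : V₁ ω' = V₁ ω := h'
    change Z ω' = Z ω
    rw [← h, h'', e1]
  have a2 : μ (Z ⁻¹' {Z ω} ∩ V₂ ⁻¹' {V₂ ω}) = μ (V₂ ⁻¹' {V₂ ω}) := by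
    refine measure_congr ?_
    filter_upwards [h₂] with ω' h
    refine propext ⟨fun h' => h'.2, fun h' => ⟨?_, h'⟩⟩
    have h'' : V₂ ω' = V₂ ω := h'
    change Z ω' = Z ω
    rw [← h, h'', e2]
  have a3 : μ (Z ⁻¹' {Z ω} ∩ (V₁ ⁻¹' {V₁ ω} ∩ V₂ ⁻¹' {V₂ ω})) =
      μ ((fun ω => (V₁ ω, V₂ ω)) ⁻¹' {(V₁ ω, V₂ ω)}) := by
    refine measure_congr ?_
    filter_upwards [h₁] with ω' h
    refine propext ⟨fun h' => Prod.ext h'.2.1 h'.2.2, fun h' => ?_⟩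
    have h'' : (V₁ ω', V₂ ω') = (V₁ ω, V₂ ω) := h'
    have h3 : V₁ ω' = V₁ ω := congrArg Prod.fst h''
    have h4 : V₂ ω' = V₂ ω := congrArg Prod.snd h''
    refine ⟨?_, h3, h4⟩
    change Z ω' = Z ω
    rw [← h, h3, e1]
  rw [a1, a2, a3] at hind
  have hr := congrArg ENNReal.toReal hind
  simp only [ENNReal.toReal_mul, ENNReal.toReal_inv] at hr
  have q0 := ENNReal.toReal_pos p0 (measure_ne_top _ _)
  have q1 := ENNReal.toReal_pos p1 (measure_ne_top _ _)
  have q2 := ENNReal.toReal_pos p2 (measure_ne_top _ _)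
  have q12 := ENNReal.toReal_pos p12 (measure_ne_top _ _)
  have hl := congrArg (Real.logb 2) hr
  rw [Real.logb_mul (by positivity) (by positivity), Real.logb_mul (by positivity) (by positivity),
    Real.logb_mul (by positivity) (by positivity), Real.logb_mul (by positivity) (by positivity),
    Real.logb_inv] at hl
  unfold infoI
  linarith

end helpers

/-- Entropic Balog–Szemerédi–Gowers theorem: if `𝐀{X,Y} ≥ (3/2)·H{X} + (3/2)·H{Y} − log C`
and `(X₁, Y₁)`, `(X₂, Y₂)` are conditionally independent trials of `(X,Y)` relative to
`X+Y`, then `H{X₁ | X+Y} ≥ H{X} − 2·log C`, `H{Y₂ | X+Y} ≥ H{Y} − 2·log C`, the variables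
`X₁` and `Y₂` are conditionally independent relative to `X+Y`, and
`H{X₁ + Y₂ | X+Y} ≤ (1/2)·H{X} + (1/2)·H{Y} + log C`.
Here `𝐀{X,Y} = 2·H{X,Y} − H{X+Y}`. -/
theorem stmt7 {Ω G : Type*} [MeasurableSpace Ω] [AddCommGroup G] [Countable G]
    [MeasurableSpace G] [MeasurableSingletonClass G]
    (μ : Measure Ω) [IsProbabilityMeasure μ]
    (X Y X₁ Y₁ X₂ Y₂ : Ω → G)
    (hmX : Measurable X) (hmY : Measurable Y) (hmX₁ : Measurable X₁)
    (hmY₁ : Measurable Y₁) (hmX₂ : Measurable X₂) (hmY₂ : Measurable Y₂)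
    (hfX : FinEnt μ X) (hfY : FinEnt μ Y)
    (hfXY : FinEnt μ (fun ω => (X ω, Y ω)))
    (C : ℝ) (hC : 0 < C)
    (henergy : 2 * entH μ (fun ω => (X ω, Y ω)) - entH μ (fun ω => X ω + Y ω)
      ≥ (3 / 2) * entH μ X + (3 / 2) * entH μ Y - Real.logb 2 C)
    -- the trials sum to `X + Y`:
    (hsum1 : ∀ᵐ ω ∂μ, X₁ ω + Y₁ ω = X ω + Y ω)
    (hsum2 : ∀ᵐ ω ∂μ, X₂ ω + Y₂ ω = X ω + Y ω)
    -- conditionally on each value of `X+Y`, the trials `(X₁,Y₁)` and `(X₂,Y₂)` are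
    -- independent and each is distributed as `(X,Y)`:
    (htrials : ∀ z : G, μ ((fun ω => X ω + Y ω) ⁻¹' {z}) ≠ 0 →
      IndepFun (fun ω => (X₁ ω, Y₁ ω)) (fun ω => (X₂ ω, Y₂ ω))
          (μ[|(fun ω => X ω + Y ω) ⁻¹' {z}]) ∧
        Measure.map (fun ω => (X₁ ω, Y₁ ω)) (μ[|(fun ω => X ω + Y ω) ⁻¹' {z}]) =
          Measure.map (fun ω => (X ω, Y ω)) (μ[|(fun ω => X ω + Y ω) ⁻¹' {z}]) ∧
        Measure.map (fun ω => (X₂ ω, Y₂ ω)) (μ[|(fun ω => X ω + Y ω) ⁻¹' {z}]) =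
          Measure.map (fun ω => (X ω, Y ω)) (μ[|(fun ω => X ω + Y ω) ⁻¹' {z}])) :
    condEntH μ X₁ (fun ω => X ω + Y ω) ≥ entH μ X - 2 * Real.logb 2 C ∧
    condEntH μ Y₂ (fun ω => X ω + Y ω) ≥ entH μ Y - 2 * Real.logb 2 C ∧
    (∀ z : G, μ ((fun ω => X ω + Y ω) ⁻¹' {z}) ≠ 0 →
      IndepFun X₁ Y₂ (μ[|(fun ω => X ω + Y ω) ⁻¹' {z}])) ∧
    condEntH μ (fun ω => X₁ ω + Y₂ ω) (fun ω => X ω + Y ω)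
      ≤ (1 / 2) * entH μ X + (1 / 2) * entH μ Y + Real.logb 2 C := by
  have hadd : Measurable (fun p : G × G => p.1 + p.2) := Measurable.of_discrete
  have hZ : Measurable (fun ω => X ω + Y ω) := hadd.comp (hmX.prodMk hmY)
  have hm1 : Measurable (fun ω => (X₁ ω, Y₁ ω)) := hmX₁.prodMk hmY₁
  have hm2 : Measurable (fun ω => (X₂ ω, Y₂ ω)) := hmX₂.prodMk hmY₂
  have hmXY : Measurable (fun ω => (X ω, Y ω)) := hmX.prodMk hmY
  have law1 := trial_law μ X Y X₁ Y₁ hmX hmY hmX₁ hmY₁ hZ hsum1 (fun z hz => (htrials z hz).2.1)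
  have law2 := trial_law μ X Y X₂ Y₂ hmX hmY hmX₂ hmY₂ hZ hsum2 (fun z hz => (htrials z hz).2.2)
  have mfst : Measurable (Prod.fst : G × G → G) := measurable_fst
  have msnd : Measurable (Prod.snd : G × G → G) := measurable_snd
  have lawX1 : μ.map X₁ = μ.map X := by
    have := congrArg (Measure.map Prod.fst) law1
    rwa [Measure.map_map mfst hm1, Measure.map_map mfst hmXY] at this
  have lawX2 : μ.map X₂ = μ.map X := by
    have := congrArg (Measure.map Prod.fst) law2
    rwa [Measure.map_map mfst hm2, Measure.map_map mfst hmXY] at this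
  have lawY1 : μ.map Y₁ = μ.map Y := by
    have := congrArg (Measure.map Prod.snd) law1
    rwa [Measure.map_map msnd hm1, Measure.map_map msnd hmXY] at this
  have lawY2 : μ.map Y₂ = μ.map Y := by
    have := congrArg (Measure.map Prod.snd) law2
    rwa [Measure.map_map msnd hm2, Measure.map_map msnd hmXY] at this
  rw [finEnt_iff μ X hmX] at hfX
  rw [finEnt_iff μ Y hmY] at hfY
  rw [finEnt_iff μ _ hmXY] at hfXY
  have iZ := infoI_integrable_mono μ (fun ω => (X ω, Y ω)) (fun ω => X ω + Y ω) hZ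
    (fun p => p.1 + p.2) (by simp) hfXY
  obtain ⟨i1, e1⟩ := entH_of_map_eq μ _ _ hm1 hmXY law1 hfXY
  obtain ⟨i2, e2⟩ := entH_of_map_eq μ _ _ hm2 hmXY law2 hfXY
  obtain ⟨iX1, eX1⟩ := entH_of_map_eq μ _ _ hmX₁ hmX lawX1 hfX
  obtain ⟨iX2, eX2⟩ := entH_of_map_eq μ _ _ hmX₂ hmX lawX2 hfX
  obtain ⟨iY1, eY1⟩ := entH_of_map_eq μ _ _ hmY₁ hmY lawY1 hfY
  obtain ⟨iY2, eY2⟩ := entH_of_map_eq μ _ _ hmY₂ hmY lawY2 hfY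
  have iZX1 := infoI_integrable_mono μ (fun ω => (X₁ ω, Y₁ ω)) (fun ω => (X ω + Y ω, X₁ ω))
    (hZ.prodMk hmX₁) (fun p => (p.1 + p.2, p.1)) (by
      filter_upwards [hsum1] with ω h
      simp [h]) i1
  have iZY2 := infoI_integrable_mono μ (fun ω => (X₂ ω, Y₂ ω)) (fun ω => (X ω + Y ω, Y₂ ω))
    (hZ.prodMk hmY₂) (fun p => (p.1 + p.2, p.2)) (by
      filter_upwards [hsum2] with ω h
      simp [h]) i2
  have g1 := integral_mono_ae i1 iZX1 (infoI_mono μ (fun ω => (X ω + Y ω, X₁ ω))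
    (fun ω => (X₁ ω, Y₁ ω)) (fun p => (p.2, p.1 - p.2)) (by
      filter_upwards [hsum1] with ω h
      simp [← h]))
  have g2 := integral_mono_ae i2 iZY2 (infoI_mono μ (fun ω => (X ω + Y ω, Y₂ ω))
    (fun ω => (X₂ ω, Y₂ ω)) (fun p => (p.1 - p.2, p.2)) (by
      filter_upwards [hsum2] with ω h
      simp [← h]))
  have iZX : Integrable (infoI μ (fun ω => (X ω + Y ω, X ω))) μ :=
    (subadd μ _ _ hZ hmX iZ hfX).1
  have iZY : Integrable (infoI μ (fun ω => (X ω + Y ω, Y ω))) μ :=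
    (subadd μ _ _ hZ hmY iZ hfY).1
  have g3 := integral_mono_ae hfXY iZX (infoI_mono μ (fun ω => (X ω + Y ω, X ω))
    (fun ω => (X ω, Y ω)) (fun p => (p.2, p.1 - p.2)) (by simp))
  have g4 := integral_mono_ae hfXY iZY (infoI_mono μ (fun ω => (X ω + Y ω, Y ω))
    (fun ω => (X ω, Y ω)) (fun p => (p.1 - p.2, p.2)) (by simp))
  have s1 := (subadd μ _ _ hZ hmX iZ hfX).2
  have s2 := (subadd μ _ _ hZ hmY iZ hfY).2
  have s3 := (subadd μ _ _ hmX hmY hfX hfY).2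
  rw [entH_eq μ _ hmXY hfXY, entH_eq μ _ hZ iZ, entH_eq μ _ hmX hfX, entH_eq μ _ hmY hfY] at henergy
  rw [entH_eq μ _ hmX hfX, entH_eq μ _ hmY hfY, condEntH_eq μ _ _ hmX₁ hZ iZX1,
    condEntH_eq μ _ _ hmY₂ hZ iZY2]
  refine ⟨by linarith, by linarith, fun z hz => (htrials z hz).1.comp mfst msnd, ?_⟩
  have hsub : Measurable (fun p : G × G => p.1 - p.2) := Measurable.of_discrete
  have hD : Measurable (fun ω => X₁ ω - X₂ ω) := hsub.comp (hmX₁.prodMk hmX₂)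
  have hW : Measurable (fun ω => X₁ ω + Y₂ ω) := hadd.comp (hmX₁.prodMk hmY₂)
  obtain ⟨iXX, sXX⟩ := subadd μ _ _ hmX₁ hmX₂ iX1 iX2
  obtain ⟨iYY, sYY⟩ := subadd μ _ _ hmY₁ hmY₂ iY1 iY2
  have iD := infoI_integrable_mono μ (fun ω => (X₁ ω, X₂ ω)) (fun ω => X₁ ω - X₂ ω) hD
    (fun p => p.1 - p.2) (by simp) iXX
  obtain ⟨iA, sA⟩ := submod μ (fun ω => (X₁ ω, X₂ ω)) (fun ω => (Y₁ ω, Y₂ ω))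
    (fun ω => X₁ ω - X₂ ω) (hmX₁.prodMk hmX₂) (hmY₁.prodMk hmY₂) hD
    (fun p => p.1 - p.2) (fun p => p.2 - p.1) (by simp) (by
      filter_upwards [hsum1, hsum2] with ω h1 h2
      rw [sub_eq_sub_iff_add_eq_add, h1, ← h2, add_comm]) iXX iYY
  have iQ := infoI_integrable_mono μ (fun ω => ((X₁ ω, X₂ ω), (Y₁ ω, Y₂ ω)))
    (fun ω => ((X₁ ω, Y₁ ω), (X₂ ω, Y₂ ω))) (hm1.prodMk hm2)
    (fun p => ((p.1.1, p.2.1), (p.1.2, p.2.2))) (by simp) iA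
  have gA := integral_mono_ae iQ iA (infoI_mono μ (fun ω => ((X₁ ω, X₂ ω), (Y₁ ω, Y₂ ω)))
    (fun ω => ((X₁ ω, Y₁ ω), (X₂ ω, Y₂ ω)))
    (fun p => ((p.1.1, p.2.1), (p.1.2, p.2.2))) (by simp))
  have eQ := integral_congr_ae (trial_info μ (fun ω => X ω + Y ω) (fun ω => (X₁ ω, Y₁ ω))
    (fun ω => (X₂ ω, Y₂ ω)) hZ (fun p => p.1 + p.2) (fun p => p.1 + p.2) hsum1 hsum2
    (fun z hz => (htrials z hz).1))
  have i12 : Integrable (fun ω => infoI μ (fun ω => (X₁ ω, Y₁ ω)) ω +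
      infoI μ (fun ω => (X₂ ω, Y₂ ω)) ω) μ := i1.add i2
  rw [integral_sub i12 iZ, integral_add i1 i2] at eQ
  obtain ⟨iZD, sZD⟩ := subadd μ _ _ hZ hD iZ iD
  have hWD : ∀ᵐ ω ∂μ, (X ω + Y ω, X₁ ω + Y₂ ω) =
      (fun p : G × G => (p.1, p.2 + p.1)) (X ω + Y ω, X₁ ω - X₂ ω) := by
    filter_upwards [hsum2] with ω h
    simp only [← h]
    congr 1
    abel
  have iZW := infoI_integrable_mono μ (fun ω => (X ω + Y ω, X₁ ω - X₂ ω))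
    (fun ω => (X ω + Y ω, X₁ ω + Y₂ ω)) (hZ.prodMk hW) (fun p => (p.1, p.2 + p.1)) hWD iZD
  have gW := integral_mono_ae iZW iZD (infoI_mono μ (fun ω => (X ω + Y ω, X₁ ω - X₂ ω))
    (fun ω => (X ω + Y ω, X₁ ω + Y₂ ω)) (fun p => (p.1, p.2 + p.1)) hWD)
  rw [condEntH_eq μ _ _ hW hZ iZW]
  linarith
end

section
/- Let A be a finite nonempty subset of an abelian group, let X and X' be independent random variables each uniformly distributed on A. Then H{X+X'} − H{X} ≥ 3·log|A| − log E(A,A). -/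
open MeasureTheory ProbabilityTheory Real

open Pointwise

/-- The additive energy `E(A,B)`: the number of quadruples `(a, a', b, b')` in
`A × A × B × B` with `a + b = a' + b'`. -/
def addEnergy {G : Type*} [AddCommGroup G] [DecidableEq G] (A B : Finset G) : ℕ :=
  (((A ×ˢ A) ×ˢ B ×ˢ B).filter fun x => x.1.1 + x.2.1 = x.1.2 + x.2.2).card

lemma aux_ent {G : Type*} (S : Finset G) (p : G → ℝ) (hp : ∀ s ∈ S, 0 < p s)
    (hsum : ∑ s ∈ S, p s = 1) :
    ∑ s ∈ S, p s * Real.logb 2 (p s) ≤ Real.logb 2 (∑ s ∈ S, p s ^ 2) := by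
  have h := strictConcaveOn_log_Ioi.concaveOn.le_map_sum (t := S) (w := p) (p := p)
    (fun i hi => (hp i hi).le) hsum (fun i hi => hp i hi)
  simp only [smul_eq_mul] at h
  have h2 : (0:ℝ) < Real.log 2 := Real.log_pos (by norm_num)
  simp only [Real.logb, pow_two]
  rw [le_div_iff₀ h2, Finset.sum_mul]
  refine le_trans (le_of_eq ?_) h
  refine Finset.sum_congr rfl fun i _ => ?_
  field_simp

lemma aux_full {Ω G : Type*} [MeasurableSpace Ω] [DecidableEq G]
    [MeasurableSpace G] [MeasurableSingletonClass G]
    (μ : Measure Ω) [IsProbabilityMeasure μ]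
    (A : Finset G) (hA : A.Nonempty)
    (X : Ω → G) (hmX : Measurable X)
    (hunifX : ∀ g : G, μ (X ⁻¹' {g}) = if g ∈ A then (A.card : ENNReal)⁻¹ else 0) :
    ∀ᵐ ω ∂μ, X ω ∈ A := by
  have h1 : μ (X ⁻¹' (A : Set G)) = 1 := by
    rw [← sum_measure_preimage_singleton A (fun y _ => hmX (measurableSet_singleton y))]
    rw [Finset.sum_congr rfl (fun g hg => by rw [hunifX g, if_pos hg])]
    rw [Finset.sum_const, nsmul_eq_mul]
    exact ENNReal.mul_inv_cancel (by simpa using hA.ne_empty) (by simp)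
  have h2 : MeasurableSet (X ⁻¹' (A : Set G)) := hmX A.measurableSet
  exact (prob_compl_eq_zero_iff h2).2 h1

lemma aux_sum {Ω G : Type*} [MeasurableSpace Ω] [AddCommGroup G] [DecidableEq G]
    [MeasurableSpace G] [MeasurableSingletonClass G]
    (μ : Measure Ω) [IsProbabilityMeasure μ]
    (A : Finset G) (hA : A.Nonempty)
    (X X' : Ω → G) (hmX : Measurable X) (hmX' : Measurable X')
    (hunifX : ∀ g : G, μ (X ⁻¹' {g}) = if g ∈ A then (A.card : ENNReal)⁻¹ else 0)
    (hunifX' : ∀ g : G, μ (X' ⁻¹' {g}) = if g ∈ A then (A.card : ENNReal)⁻¹ else 0)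
    (hindep : IndepFun X X' μ) (s : G) :
    (μ ((fun ω => X ω + X' ω) ⁻¹' {s})).toReal
      = (((A ×ˢ A).filter fun x => x.1 + x.2 = s).card : ℝ) / (A.card : ℝ) ^ 2 := by
  have e : μ ((fun ω => X ω + X' ω) ⁻¹' {s})
      = μ (⋃ x ∈ (A ×ˢ A).filter (fun x => x.1 + x.2 = s), X ⁻¹' {x.1} ∩ X' ⁻¹' {x.2}) := by
    refine measure_congr (Filter.eventuallyEq_set.2 ?_)
    filter_upwards [aux_full μ A hA X hmX hunifX, aux_full μ A hA X' hmX' hunifX'] with ω h1 h2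
    simp only [Set.mem_preimage, Set.mem_singleton_iff, Set.mem_iUnion, Finset.mem_filter,
      Finset.mem_product, Set.mem_inter_iff, exists_prop]
    constructor
    · intro h
      exact ⟨(X ω, X' ω), ⟨⟨h1, h2⟩, h⟩, rfl, rfl⟩
    · rintro ⟨x, ⟨_, h⟩, h3, h4⟩
      rw [h3, h4, h]
  rw [e, measure_biUnion_finset]
  · rw [Finset.sum_congr rfl (g := fun _ => (A.card : ENNReal)⁻¹ * (A.card : ENNReal)⁻¹)]
    · rw [Finset.sum_const, nsmul_eq_mul]
      simp only [ENNReal.toReal_mul, ENNReal.toReal_inv, ENNReal.toReal_natCast]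
      rw [div_eq_mul_inv, pow_two, mul_inv]
    · intro x hx
      simp only [Finset.mem_filter, Finset.mem_product] at hx
      rw [hindep.measure_inter_preimage_eq_mul _ _ (measurableSet_singleton _)
        (measurableSet_singleton _), hunifX, hunifX', if_pos hx.1.1, if_pos hx.1.2]
  · intro x _ y _ hxy
    refine Set.disjoint_left.2 ?_
    rintro ω ⟨h1, h2⟩ ⟨h3, h4⟩
    simp only [Set.mem_preimage, Set.mem_singleton_iff] at h1 h2 h3 h4
    exact hxy (Prod.ext (h1.symm.trans h3) (h2.symm.trans h4))
  · intro x _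
    exact (hmX (measurableSet_singleton _)).inter (hmX' (measurableSet_singleton _))

/-- If `X` and `X'` are independent random variables each uniformly distributed on a
finite nonempty set `A`, then `H{X+X'} − H{X} ≥ 3·log|A| − log E(A,A)`. -/
theorem stmt13 {Ω G : Type*} [MeasurableSpace Ω] [AddCommGroup G] [DecidableEq G]
    [MeasurableSpace G] [MeasurableSingletonClass G]
    (μ : Measure Ω) [IsProbabilityMeasure μ]
    (A : Finset G) (hA : A.Nonempty)
    (X X' : Ω → G) (hmX : Measurable X) (hmX' : Measurable X')
    (hunifX : ∀ g : G, μ (X ⁻¹' {g}) = if g ∈ A then (A.card : ENNReal)⁻¹ else 0)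
    (hunifX' : ∀ g : G, μ (X' ⁻¹' {g}) = if g ∈ A then (A.card : ENNReal)⁻¹ else 0)
    (hindep : IndepFun X X' μ) :
    entH μ (fun ω => X ω + X' ω) - entH μ X
      ≥ 3 * Real.logb 2 (A.card : ℝ) - Real.logb 2 (addEnergy A A : ℝ) := by
  have hn : (0:ℝ) < A.card := by exact_mod_cast hA.card_pos
  have hHX : entH μ X = Real.logb 2 (A.card : ℝ) := by
    unfold entH
    rw [tsum_eq_sum (s := A)]
    · rw [Finset.sum_congr rfl (g := fun _ => (A.card : ℝ)⁻¹ * Real.logb 2 (A.card : ℝ))]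
      · rw [Finset.sum_const, nsmul_eq_mul]
        field_simp
      · intro g hg
        rw [hunifX, if_pos hg]
        simp [Real.logb_inv]
    · intro g hg
      rw [hunifX, if_neg hg]
      simp
  set r : G → ℕ := fun s => ((A ×ˢ A).filter fun x => x.1 + x.2 = s).card with hr
  have hE : addEnergy A A = ∑ s ∈ A + A, r s ^ 2 := Finset.addEnergy_eq_sum_sq' A A
  have hS : ∑ s ∈ A + A, r s = A.card ^ 2 := by
    rw [pow_two, ← Finset.card_product]
    refine (Finset.card_eq_sum_card_fiberwise ?_).symm
    intro x hx
    have hx' := Finset.mem_product.1 hx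
    exact Finset.add_mem_add hx'.1 hx'.2
  have hpos : ∀ s ∈ A + A, 0 < r s := by
    intro s hs
    obtain ⟨a, ha, b, hb, h⟩ := Finset.mem_add.1 hs
    exact Finset.card_pos.2 ⟨(a, b), by simp [ha, hb, h]⟩
  have hzero : ∀ s ∉ A + A, r s = 0 := by
    intro s hs
    refine Finset.card_eq_zero.2 (Finset.filter_eq_empty_iff.2 ?_)
    intro x hx h
    have hx' := Finset.mem_product.1 hx
    exact hs (h ▸ Finset.add_mem_add hx'.1 hx'.2)
  have hp := aux_sum μ A hA X X' hmX hmX' hunifX hunifX' hindep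
  have hHS : entH μ (fun ω => X ω + X' ω) = - ∑ s ∈ A + A,
      ((r s : ℝ) / (A.card : ℝ) ^ 2) * Real.logb 2 ((r s : ℝ) / (A.card : ℝ) ^ 2) := by
    unfold entH
    simp only [hp]
    rw [tsum_eq_sum (s := A + A), Finset.sum_neg_distrib]
    intro s hs
    have h0 := hzero s hs
    simp only [hr] at h0
    rw [h0]
    simp
  have hmain := aux_ent (A + A) (fun s => (r s : ℝ) / (A.card : ℝ) ^ 2)
    (fun s hs => div_pos (by exact_mod_cast hpos s hs) (by positivity))
    (by
      rw [← Finset.sum_div, ← Nat.cast_sum, hS]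
      push_cast
      exact div_self (by positivity))
  have hQ : ∑ s ∈ A + A, ((r s : ℝ) / (A.card : ℝ) ^ 2) ^ 2
      = (addEnergy A A : ℝ) / (A.card : ℝ) ^ 4 := by
    rw [hE]
    push_cast
    rw [Finset.sum_div]
    refine Finset.sum_congr rfl fun s _ => ?_
    rw [div_pow, ← pow_mul]
  have hEpos : (0:ℝ) < addEnergy A A := by
    rw [hE]
    exact_mod_cast Finset.sum_pos (fun s hs => pow_pos (hpos s hs) 2) (hA.add hA)
  rw [hQ, Real.logb_div hEpos.ne' (by positivity), Real.logb_pow] at hmain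
  rw [hHS, hHX]
  push_cast at hmain
  linarith
end
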